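/- arXiv:2502.04311 — 3 statements merged into one kernel-verified Lean document; each statement's English description precedes it below -/
import Mathlib

section
/- Suppose the Ramsey number R_G(X,C) (with maximal base G = {G_i}_{i∈I}) exists and is of Galois type with prime-power color set F_q. Treating each p[G_i,X,C] as a polynomial function on F_q^{E(G_i)}, let i_m = max{ i ∈ I : p[G_i,X,C] is not identically zero } and i_k = min{ i ∈ I : p[G_i,X,C] is identically zero }. Then the successor of i_m in I equals R_G(X,C), which equals i_k. -/
namespace RamseyGen

open SimpleGraph

/-- A copy of the finite undirected graph `X` inside `G`: an injective vertex map
preserving adjacency.  Such copies correspond exactly to graph isomorphisms from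
subgraphs `Y ≤ G` onto `X`, i.e. to the elements `π` of the isomorphism set `G/X`
(a copy is the inverse of the edge map `π : E(Y) → E(X)`).  In particular
`G/X ≠ ∅` iff `Nonempty (Copy X G)`. -/
structure Copy {W V : Type*} (X : SimpleGraph W) (G : SimpleGraph V) where
  toFun : W → V
  injective : Function.Injective toFun
  map_adj : ∀ {a b : W}, X.Adj a b → G.Adj (toFun a) (toFun b)

theorem Copy.edgeMap_mem {W V : Type*} {X : SimpleGraph W} {G : SimpleGraph V}
    (f : Copy X G) (e : X.edgeSet) : e.1.map f.toFun ∈ G.edgeSet := by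
  obtain ⟨e, he⟩ := e
  induction e using Sym2.ind with
  | _ a b =>
    rw [Sym2.map_pair_eq, SimpleGraph.mem_edgeSet]
    exact f.map_adj (X.mem_edgeSet.mp he)

/-- The map on edges induced by a copy (the inverse of the edge map `π ∈ G/X`). -/
def Copy.edgeMap {W V : Type*} {X : SimpleGraph W} {G : SimpleGraph V}
    (f : Copy X G) (e : X.edgeSet) : G.edgeSet :=
  ⟨e.1.map f.toFun, f.edgeMap_mem e⟩

instance {W V : Type*} [Finite W] [Finite V] {X : SimpleGraph W} {G : SimpleGraph V} :
    Finite (Copy X G) :=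
  Finite.of_injective (fun f => f.toFun) fun f g h => by cases f; cases g; simpa using h

/-- `Hits X ψ G ρ` says: there is `π ∈ G/X` with `ρ|_{π⁻¹(X)} = ψ ∘ π`, i.e. the
edge-coloring `ρ` of `G` restricts, on some subgraph of `G` isomorphic to `X`,
to the target coloring `ψ` of `X`. -/
def Hits {W V A : Type*} (X : SimpleGraph W) (ψ : X.edgeSet → A)
    (G : SimpleGraph V) (ρ : G.edgeSet → A) : Prop :=
  ∃ f : Copy X G, ∀ e : X.edgeSet, ρ (f.edgeMap e) = ψ e

/-- A family of graphs indexed by a (strictly well-)ordered set is hereditary if the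
graphs increase, with respect to containment, along the order. -/
def Hereditary {I : Type*} [LT I] {Vtx : I → Type*} (G : ∀ i, SimpleGraph (Vtx i)) : Prop :=
  ∀ a b : I, a < b → Nonempty (Copy (G a) (G b))

/-- The isomorphism set `G/X`, realized as the (finite) set of induced edge
correspondences (each recorded as the map `E(X) → E(G)` inverse to `π : E(Y) → E(X)`). -/
noncomputable def isoSet {W V : Type*} [Finite W] [Finite V]
    (X : SimpleGraph W) (G : SimpleGraph V) : Finset (X.edgeSet → G.edgeSet) := by
  classical
  letI : Fintype (Copy X G) := Fintype.ofFinite _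
  exact Finset.univ.image (fun f : Copy X G => f.edgeMap)

/-- The `(X,ψ)`-indicator polynomial
`p[G,X,ψ] = ∏_{π ∈ G/X} (1 − ∏_{e ∈ E(X)} (1 − (x_{π(e)} − ψ(e))^(q−1)))`
in `F[x_e : e ∈ E(G)]`, where `q = |F|`. -/
noncomputable def indicator {W V : Type*} [Finite W] [Finite V]
    (G : SimpleGraph V) (X : SimpleGraph W)
    {F : Type*} [Field F] [Fintype F] (ψ : X.edgeSet → F) :
    MvPolynomial G.edgeSet F := by
  classical
  letI : Fintype X.edgeSet := Fintype.ofFinite _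
  exact ∏ π ∈ isoSet X G,
    (1 - ∏ e : X.edgeSet,
      (1 - (MvPolynomial.X (π e) - MvPolynomial.C (ψ e)) ^ (Fintype.card F - 1)))

/-- `p[G,𝕏,𝒞] = ∏_{j ∈ J} p[G,X_j,ψ_j]`. -/
noncomputable def indicatorFam {V : Type*} [Finite V] (G : SimpleGraph V)
    {J : Type*} [Finite J] {Wt : J → Type*} [∀ j, Finite (Wt j)]
    (X : ∀ j, SimpleGraph (Wt j))
    {F : Type*} [Field F] [Fintype F] (ψ : ∀ j, (X j).edgeSet → F) :
    MvPolynomial G.edgeSet F := by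
  classical
  letI : Fintype J := Fintype.ofFinite _
  exact ∏ j : J, indicator G (X j) (ψ j)

/-- Copies compose. -/
def Copy.comp {U W V : Type*} {X : SimpleGraph U} {H : SimpleGraph W} {G : SimpleGraph V}
    (g : Copy H G) (f : Copy X H) : Copy X G where
  toFun := g.toFun ∘ f.toFun
  injective := g.injective.comp f.injective
  map_adj h := g.map_adj (f.map_adj h)

theorem Copy.edgeMap_comp {U W V : Type*} {X : SimpleGraph U} {H : SimpleGraph W}
    {G : SimpleGraph V} (g : Copy H G) (f : Copy X H) (e : X.edgeSet) :
    (g.comp f).edgeMap e = g.edgeMap (f.edgeMap e) :=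
  Subtype.ext (Sym2.map_map (g := g.toFun) (f := f.toFun) e.1).symm

/-- A hit of the coloring pulled back along a copy of `H` in `G` gives a hit in `G`. -/
theorem Hits.of_copy {U W V A : Type*} {X : SimpleGraph U} {ψ : X.edgeSet → A}
    {H : SimpleGraph W} {G : SimpleGraph V} (g : Copy H G) {ρ : G.edgeSet → A}
    (h : Hits X ψ H (ρ ∘ g.edgeMap)) : Hits X ψ G ρ := by
  obtain ⟨f, hf⟩ := h
  exact ⟨g.comp f, fun e => by rw [Copy.edgeMap_comp]; exact hf e⟩

theorem one_sub_prod_one_sub_pow_eq_zero_iff {F : Type*} [Field F] [Fintype F]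
    {E : Type*} [Fintype E] (u v : E → F) :
    1 - ∏ e, (1 - (u e - v e) ^ (Fintype.card F - 1)) = 0 ↔ ∀ e, u e = v e := by
  have hq : Fintype.card F - 1 ≠ 0 := by
    have := Fintype.one_lt_card (α := F)
    omega
  constructor
  · intro h e
    by_contra hne
    rw [Finset.prod_eq_zero (Finset.mem_univ e), sub_zero] at h
    · exact one_ne_zero h
    · rw [FiniteField.pow_card_sub_one_eq_one _ (sub_ne_zero.mpr hne), sub_self]
  · intro h
    simp [h, hq]

theorem eval_indicator_eq_zero_iff {W V : Type*} [Finite W] [Finite V]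
    (G : SimpleGraph V) (X : SimpleGraph W) {F : Type*} [Field F] [Fintype F]
    (ψ : X.edgeSet → F) (ρ : G.edgeSet → F) :
    MvPolynomial.eval ρ (indicator G X ψ) = 0 ↔ Hits X ψ G ρ := by
  classical
  simp only [indicator, isoSet, map_prod, map_sub, map_one, map_pow, MvPolynomial.eval_X,
    MvPolynomial.eval_C, Finset.prod_eq_zero_iff, one_sub_prod_one_sub_pow_eq_zero_iff,
    Finset.mem_image, Finset.mem_univ, true_and, exists_exists_eq_and, Hits]

theorem eval_indicatorFam_eq_zero_iff {V : Type*} [Finite V] (G : SimpleGraph V)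
    {J : Type*} [Finite J] {Wt : J → Type*} [∀ j, Finite (Wt j)]
    (X : ∀ j, SimpleGraph (Wt j)) {F : Type*} [Field F] [Fintype F]
    (ψ : ∀ j, (X j).edgeSet → F) (ρ : G.edgeSet → F) :
    MvPolynomial.eval ρ (indicatorFam G X ψ) = 0 ↔ ∃ j, Hits (X j) (ψ j) G ρ := by
  simp only [indicatorFam, map_prod, Finset.prod_eq_zero_iff, Finset.mem_univ, true_and,
    eval_indicator_eq_zero_iff]

/-- In a hereditary family, the indices at which every coloring is hit form an upper set. -/
theorem Hereditary.isUpperSet_hits {I : Type*} [PartialOrder I] {Vtx : I → Type*}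
    {G : ∀ i, SimpleGraph (Vtx i)} (hG : Hereditary G) {J : Type*} {Wt : J → Type*}
    (X : ∀ j, SimpleGraph (Wt j)) {A : Type*} (ψ : ∀ j, (X j).edgeSet → A) :
    IsUpperSet {i | ∀ ρ : (G i).edgeSet → A, ∃ j, Hits (X j) (ψ j) (G i) ρ} := by
  intro a b hab ha ρ
  obtain rfl | hlt := hab.eq_or_lt
  · exact ha ρ
  · obtain ⟨g⟩ := hG a b hlt
    obtain ⟨j, hj⟩ := ha (ρ ∘ g.edgeMap)
    exact ⟨j, hj.of_copy g⟩

/-- Theorem: the Ramsey number of Galois type with maximal base is the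
bifurcation point of vanishing of the indicator polynomials.  Suppose the Ramsey number
`R_𝔾(𝕏,𝒞)` exists (its value being `r`, the least admissible threshold) and is of Galois
type with maximal base: `G` is a hereditary family of finite graphs over a strictly
well-ordered index set `I`, every `F`-valued coloring is admissible, and the uniform
finite-type symbol `(X j, ψ j)_{j∈J}` is colored by the finite field `F` (of prime power
order `q = |F|`).  Treating each `p[G_i,𝕏,𝒞]` as a polynomial function on `F^{E(G_i)}`,
let `i_m = max {i ∈ I : p[G_i,𝕏,𝒞] ≠ 0}` and `i_k = min {i ∈ I : p[G_i,𝕏,𝒞] = 0}`.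
Then the successor of `i_m` in `I` equals `R_𝔾(𝕏,𝒞) = r`, which equals `i_k`. -/
theorem ramsey_eq_indicator_bifurcation
    {I : Type*} [LinearOrder I] [WellFoundedLT I]
    {Vtx : I → Type*} [∀ i, Finite (Vtx i)]
    (G : ∀ i, SimpleGraph (Vtx i)) (hG : Hereditary G)
    {J : Type*} [Finite J] {Wt : J → Type*} [∀ j, Finite (Wt j)]
    (X : ∀ j, SimpleGraph (Wt j))
    {F : Type*} [Field F] [Fintype F]
    (ψ : ∀ j, (X j).edgeSet → F)
    (r : I)
    (hr : IsLeast {n : I | ∀ t, n ≤ t →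
        ∀ ρ : (G t).edgeSet → F, ∃ j : J, Hits (X j) (ψ j) (G t) ρ} r)
    (im ik : I)
    (him : IsGreatest {i : I |
        ¬ ∀ ρ : (G i).edgeSet → F, MvPolynomial.eval ρ (indicatorFam (G i) X ψ) = 0} im)
    (hik : IsLeast {i : I |
        ∀ ρ : (G i).edgeSet → F, MvPolynomial.eval ρ (indicatorFam (G i) X ψ) = 0} ik) :
    IsLeast {t : I | im < t} r ∧ r = ik := by
  simp only [eval_indicatorFam_eq_zero_iff] at him hik
  have hup := hG.isUpperSet_hits X ψ
  refine ⟨⟨lt_of_not_ge fun h => him.1 (hr.1 im h), fun t ht => ?_⟩,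
    le_antisymm (hr.2 fun t ht => hup ht hik.1) (hik.2 (hr.1 r le_rfl))⟩
  exact hr.2 fun s hs => not_not.mp fun h => (him.2 h).not_gt (lt_of_lt_of_le ht hs)

end RamseyGen
end

section
/- Suppose the Ramsey number R_G(X,C) (with maximal base) is of Galois type with prime-power color set F_q and that R_G(X,C) = n. Then the polynomial p[G_n,X,C] belongs to the ideal of F_q[x_e : e ∈ E(G_n)] generated by the polynomials {x_e^q − x_e : e ∈ E(G_n)}. -/
namespace RamseyGen

open SimpleGraph

/-- A polynomial over a finite field that vanishes at every point lies in the ideal generated by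
the field equations. -/
theorem mem_span_field_equations_of_eval_eq_zero {σ F : Type*} [Finite σ] [Field F] [Fintype F]
    (p : MvPolynomial σ F) (hp : ∀ x : σ → F, MvPolynomial.eval x p = 0) :
    p ∈ Ideal.span (Set.range (fun i : σ =>
      (MvPolynomial.X i ^ Fintype.card F - MvPolynomial.X i : MvPolynomial σ F))) := by
  have prod_eq (i : σ) : (∏ r : F, (MvPolynomial.X i - MvPolynomial.C r) : MvPolynomial σ F) =
      MvPolynomial.X i ^ Fintype.card F - MvPolynomial.X i := by
    have roots_eq := FiniteField.roots_X_pow_card_sub_X F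
    have monic : (Polynomial.X ^ Fintype.card F - Polynomial.X : Polynomial F).Monic :=
      Polynomial.monic_X_pow_sub (by
        rw [Polynomial.degree_X]; exact_mod_cast Fintype.one_lt_card (α := F))
    have factored := Polynomial.prod_multiset_X_sub_C_of_monic_of_roots_card_eq monic (by
      rw [roots_eq, FiniteField.X_pow_card_sub_X_natDegree_eq F Fintype.one_lt_card]
      rfl)
    rw [roots_eq, Finset.prod_map_val] at factored
    simpa using congrArg (Polynomial.aeval (MvPolynomial.X i : MvPolynomial σ F)) factored
  obtain ⟨h, -, hh⟩ := MvPolynomial.combinatorial_nullstellensatz_exists_linearCombination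
    (fun _ : σ => (Finset.univ : Finset F)) (fun _ => Finset.univ_nonempty) p (fun x _ => hp x)
  simp only [prod_eq] at hh
  rw [Ideal.span, Finsupp.mem_span_range_iff_exists_finsupp]
  exact ⟨h, hh.symm⟩

/-- The indicator polynomial vanishes at every coloring containing a copy of the target. -/
theorem eval_indicator_eq_zero {W V F : Type*} [Finite W] [Finite V] [Field F] [Fintype F]
    {G : SimpleGraph V} {X : SimpleGraph W} {ψ : X.edgeSet → F} {ρ : G.edgeSet → F}
    (h : Hits X ψ G ρ) : MvPolynomial.eval ρ (indicator G X ψ) = 0 := by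
  classical
  obtain ⟨f, hf⟩ := h
  have hq : Fintype.card F - 1 ≠ 0 := (Nat.sub_pos_of_lt Fintype.one_lt_card).ne'
  rw [indicator, map_prod]
  refine Finset.prod_eq_zero (i := f.edgeMap) (by simp [isoSet]) ?_
  simp [hf, hq]

/-- Corollary: at the Ramsey number the indicator polynomial lies in the
ideal generated by the field equations.  Suppose the Ramsey number `R_𝔾(𝕏,𝒞)` is of
Galois type with maximal base (hereditary family `G` of finite graphs over a strictly
well-ordered index set `I`, all `F`-valued colorings admissible, uniform finite-type
symbol `(X j, ψ j)_{j∈J}` colored by the finite field `F` with `q = |F|` elements), and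
suppose `R_𝔾(𝕏,𝒞) = n`.  Then `p[G_n,𝕏,𝒞]` belongs to the ideal of
`F[x_e : e ∈ E(G_n)]` generated by the polynomials `{x_e^q − x_e : e ∈ E(G_n)}`. -/
theorem indicator_mem_span_field_equations
    {I : Type*} [LinearOrder I] [WellFoundedLT I]
    {Vtx : I → Type*} [∀ i, Finite (Vtx i)]
    (G : ∀ i, SimpleGraph (Vtx i)) (hG : Hereditary G)
    {J : Type*} [Finite J] {Wt : J → Type*} [∀ j, Finite (Wt j)]
    (X : ∀ j, SimpleGraph (Wt j))
    {F : Type*} [Field F] [Fintype F]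
    (ψ : ∀ j, (X j).edgeSet → F)
    (n : I)
    (hn : IsLeast {m : I | ∀ t, m ≤ t →
        ∀ ρ : (G t).edgeSet → F, ∃ j : J, Hits (X j) (ψ j) (G t) ρ} n) :
    indicatorFam (G n) X ψ ∈ Ideal.span (Set.range (fun e : (G n).edgeSet =>
      MvPolynomial.X e ^ Fintype.card F - MvPolynomial.X e)) := by
  classical
  refine mem_span_field_equations_of_eval_eq_zero _ fun ρ => ?_
  obtain ⟨j, hj⟩ := hn.1 n le_rfl ρ
  rw [indicatorFam, map_prod]
  exact Finset.prod_eq_zero (@Finset.mem_univ _ (Fintype.ofFinite J) j) (eval_indicator_eq_zero hj)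

end RamseyGen
end

section
/- Let G = {K_{i+1}}_{i∈ℕ} and, for each m ∈ ℕ, let S(m) = {S_i(m)}_{i∈ℕ} with S_i(m) = {d_{Θ[i,m]}} the singleton prime-distance coloring. Then the following are equivalent: (1) for every m ∈ ℕ the Ramsey number R_{(G,S(m))}({K_2},{2_{K_2}}) exists, where K_2 is the complete graph on 2 vertices and 2_{K_2} is its constant coloring with value 2; (2) there are infinitely many n ∈ ℕ with p_{n+1} − p_n = 2 (the Twin Prime conjecture). -/
namespace RamseyGen

open SimpleGraph

/-- The metrical ("prime-distance") edge-coloring of a graph induced by a vertex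
labelling `f : V → ℕ`: the edge joining `v` and `w` gets the color `|f v − f w|`. -/
def distColoring {V : Type*} {G : SimpleGraph V} (f : V → ℕ) (e : G.edgeSet) : ℕ :=
  Sym2.lift ⟨fun u v => Nat.dist (f u) (f v), fun u v => Nat.dist_comm (f u) (f v)⟩ e.1

theorem hits_top_fin_two_distColoring_iff {V : Type*} (f : V → ℕ) {k : ℕ} (hk : k ≠ 0) :
    Hits (⊤ : SimpleGraph (Fin 2)) (fun _ => k) (⊤ : SimpleGraph V)
      (distColoring (G := (⊤ : SimpleGraph V)) f) ↔ ∃ u v, Nat.dist (f u) (f v) = k := by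
  constructor
  · rintro ⟨c, hc⟩
    exact ⟨c.toFun 0, c.toFun 1, hc ⟨s(0, 1), by simp⟩⟩
  · rintro ⟨u, v, huv⟩
    have hne : u ≠ v := by
      rintro rfl
      exact hk (by simpa using huv.symm)
    have hinj : Function.Injective ![u, v] := by
      intro a b hab
      fin_cases a <;> fin_cases b <;> simp_all
    refine ⟨⟨![u, v], hinj, fun {a b} h => hinj.ne h⟩, ?_⟩
    rintro ⟨e, he⟩
    induction e using Sym2.ind with
    | _ a b =>
      change Nat.dist (f (![u, v] a)) (f (![u, v] b)) = k
      have hab : a ≠ b := he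
      fin_cases a <;> fin_cases b
      · exact absurd rfl hab
      · exact huv
      · exact (Nat.dist_comm _ _).trans huv
      · exact absurd rfl hab

theorem nth_prime_succ_sub_eq_two {a b : ℕ}
    (h : Nat.nth Nat.Prime a + 2 = Nat.nth Nat.Prime b) :
    Nat.nth Nat.Prime (a + 1) - Nat.nth Nat.Prime a = 2 := by
  have hmono : StrictMono (Nat.nth Nat.Prime) := Nat.nth_strictMono Nat.infinite_setOfPred_prime
  have hab : a < b := hmono.lt_iff_lt.mp (by omega)
  have h1 : Nat.nth Nat.Prime a < Nat.nth Nat.Prime (a + 1) := hmono (Nat.lt_succ_self a)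
  have h2 : Nat.nth Nat.Prime (a + 1) ≤ Nat.nth Nat.Prime b := hmono.monotone hab
  have pa := Nat.prime_nth_prime a
  have pb := Nat.prime_nth_prime b
  have pc := Nat.prime_nth_prime (a + 1)
  have := pa.two_le
  rcases pb.eq_two_or_odd with h3 | h3
  · omega
  · rcases pc.eq_two_or_odd with h4 | h4 <;> omega

theorem exists_eq_or_exists_eq_of_injective {s : ℕ} {r : Fin (s + 1) → ℕ}
    (hr : Function.Injective r) (hle : ∀ v, r v ≤ s + 1) {x y : ℕ} (hx : x ≤ s + 1)
    (hy : y ≤ s + 1) (hxy : x ≠ y) : (∃ v, r v = x) ∨ ∃ v, r v = y := by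
  by_contra! h
  have hsub : Finset.univ.image r ⊆ ((Finset.range (s + 2)).erase x).erase y := by
    intro z hz
    obtain ⟨v, -, rfl⟩ := Finset.mem_image.mp hz
    have := hle v
    simp only [Finset.mem_erase, Finset.mem_range]
    exact ⟨h.2 v, h.1 v, by omega⟩
  have hcard := Finset.card_le_card hsub
  rw [Finset.card_image_of_injective _ hr, Finset.card_erase_of_mem, Finset.card_erase_of_mem,
    Finset.card_univ, Fintype.card_fin, Finset.card_range] at hcard
  · omega
  · simp; omega
  · simp; omega

/-- Theorem: the Twin Prime conjecture as a family of Ramsey numbers.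
Let `𝔾 = {K_{i+1}}_{i∈ℕ}` and, for each `m ∈ ℕ`, let `𝒮(m) = {S_i(m)}` with
`S_i(m) = {d_{Θ[i,m]}}` the singleton prime-distance coloring of `K_{i+1}` induced by a
fixed injection `Θ[i,m] : V(K_{i+1}) → ℕ` with image contained in `{p_m, …, p_{m+i+1}}`
(with `p_r` the `r`-th prime, `Nat.nth Nat.Prime`).  Then the following are equivalent:
(1) for every `m ∈ ℕ` the Ramsey number `R_{(𝔾,𝒮(m))}({K_2},{2_{K_2}})` exists, where
`K_2` is the complete graph on two vertices and `2_{K_2}` its constant coloring with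
value `2`; (2) there are infinitely many `n ∈ ℕ` with `p_{n+1} − p_n = 2` (the Twin
Prime conjecture). -/
theorem ramsey_twin_prime
    (Θ : ∀ m i : ℕ, Fin (i + 1) → ℕ)
    (hΘinj : ∀ m i, Function.Injective (Θ m i))
    (hΘimg : ∀ m i v, ∃ r ≤ i + 1, Θ m i v = Nat.nth Nat.Prime (m + r)) :
    (∀ m : ℕ, ∃ n : ℕ, ∀ s, n ≤ s →
        ∀ ρ ∈ ({distColoring (G := (⊤ : SimpleGraph (Fin (s + 1)))) (Θ m s)} :
            Set ((⊤ : SimpleGraph (Fin (s + 1))).edgeSet → ℕ)),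
          Hits (⊤ : SimpleGraph (Fin 2)) (fun _ => 2)
            (⊤ : SimpleGraph (Fin (s + 1))) ρ) ↔
      {n : ℕ | Nat.nth Nat.Prime (n + 1) - Nat.nth Nat.Prime n = 2}.Infinite := by
  simp only [Set.mem_singleton_iff, forall_eq,
    hits_top_fin_two_distColoring_iff _ two_ne_zero]
  constructor
  · intro h
    refine Set.infinite_of_forall_exists_gt fun N => ?_
    obtain ⟨n, hn⟩ := h (N + 1)
    obtain ⟨u, v, huv⟩ := hn n le_rfl
    obtain ⟨r, -, hu⟩ := hΘimg (N + 1) n u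
    obtain ⟨t, -, hv⟩ := hΘimg (N + 1) n v
    rw [hu, hv, Nat.dist] at huv
    rcases le_total (Nat.nth Nat.Prime (N + 1 + r)) (Nat.nth Nat.Prime (N + 1 + t)) with hle | hle
    · exact ⟨N + 1 + r, nth_prime_succ_sub_eq_two (b := N + 1 + t) (by omega), by omega⟩
    · exact ⟨N + 1 + t, nth_prime_succ_sub_eq_two (b := N + 1 + r) (by omega), by omega⟩
  · intro h m
    obtain ⟨a, ha, hma⟩ := h.exists_gt m
    obtain ⟨b, hb, hab⟩ := h.exists_gt (a + 1)
    refine ⟨b, fun s hs => ?_⟩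
    choose r hr hΘr using hΘimg m s
    have hinj : Function.Injective r := fun u v huv => hΘinj m s (by rw [hΘr, hΘr, huv])
    have hit : ∀ c, m ≤ c → Nat.nth Nat.Prime (c + 1) - Nat.nth Nat.Prime c = 2 →
        (∃ u, r u = c - m) → (∃ v, r v = c + 1 - m) →
        ∃ u v, Nat.dist (Θ m s u) (Θ m s v) = 2 := by
      rintro c hmc hc ⟨u, hu⟩ ⟨v, hv⟩
      refine ⟨u, v, ?_⟩
      rw [hΘr, hΘr, hu, hv, show m + (c - m) = c by omega,
        show m + (c + 1 - m) = c + 1 by omega, Nat.dist]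
      omega
    have key : ∀ x y, x ≤ s + 1 → y ≤ s + 1 → x ≠ y → (∃ v, r v = x) ∨ ∃ v, r v = y :=
      fun x y => exists_eq_or_exists_eq_of_injective hinj hr
    have h1 := key (a - m) (b - m) (by omega) (by omega) (by omega)
    have h2 := key (a - m) (b + 1 - m) (by omega) (by omega) (by omega)
    have h3 := key (a + 1 - m) (b - m) (by omega) (by omega) (by omega)
    have h4 := key (a + 1 - m) (b + 1 - m) (by omega) (by omega) (by omega)
    have hita := hit a (by omega) ha
    have hitb := hit b (by omega) hb
    rcases h1 with ha1 | hb1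
    · rcases h3 with ha2 | hb1
      · exact hita ha1 ha2
      · rcases h4 with ha2 | hb2
        · exact hita ha1 ha2
        · exact hitb hb1 hb2
    · rcases h2 with ha1 | hb2
      · rcases h4 with ha2 | hb2
        · exact hita ha1 ha2
        · exact hitb hb1 hb2
      · exact hitb hb1 hb2

end RamseyGen
end
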